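/- Given any sector σ of vertex z and amplitude 120° (where z ∈ ℂ, z ≠ 0, and σ = σ(z,120°) is the sector with vertex z, aperture 120° and axis the ray from z through 0), there exists an index j with 1 ≤ j ≤ 8 such that the expanded octant σ̃_j(z) is contained in σ. -/

import Mathlib

open MeasureTheory Filter Set Topology
open scoped ENNReal

noncomputable section

/-- The sector `σ(z,θ)` with vertex `z`, aperture `θ` and axis the ray from `z` through `0`:
`w ∈ σ(z,θ)` iff `⟨w - z, -z⟩ ≥ cos(θ/2)·|w - z|·|z|`. -/
def sector (z : ℂ) (θ : ℝ) : Set ℂ :=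
  {w : ℂ | Real.cos (θ / 2) * (‖w - z‖ * ‖z‖) ≤ (w - z).re * (-z).re + (w - z).im * (-z).im}

/-- The expanded octant `σ̃_j`: same vertex and bisector as `σ_j` but amplitude `75°`
(i.e. `σ_j` enlarged by `15°` in each direction). -/
def expOctant (j : ℕ) : Set ℂ :=
  {w : ℂ | ∃ r : ℝ, 0 ≤ r ∧ ∃ φ : ℝ, ((j : ℝ) - 1) * Real.pi / 4 - Real.pi / 12 ≤ φ ∧
    φ ≤ (j : ℝ) * Real.pi / 4 + Real.pi / 12 ∧ w = (r : ℂ) * Complex.exp (φ * Complex.I)}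

lemma octant_aux (z : ℂ) (j : ℕ) (β : ℝ) (h1 : ((j : ℝ) - 1) * Real.pi / 4 ≤ β)
    (h2 : β ≤ (j : ℝ) * Real.pi / 4) (hre : (-z).re = ‖z‖ * Real.cos β)
    (him : (-z).im = ‖z‖ * Real.sin β) :
    (fun w => z + w) '' expOctant j ⊆ sector z (2 * Real.pi / 3) := by
  rintro _ ⟨w, ⟨r, hr, φ, ha, hb, rfl⟩, rfl⟩
  have hpi := Real.pi_pos
  have hc : Real.cos (Real.pi / 3) ≤ Real.cos (φ - β) := by
    rw [← Real.cos_abs (φ - β)]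
    apply Real.cos_le_cos_of_nonneg_of_le_pi (abs_nonneg _) (by linarith)
    rw [abs_le]
    constructor <;> linarith
  have hn : ‖(r : ℂ) * Complex.exp (φ * Complex.I)‖ = r := by
    rw [norm_mul, Complex.norm_exp_ofReal_mul_I, Complex.norm_real, Real.norm_of_nonneg hr, mul_one]
  simp only [sector, mem_setOf_eq, add_sub_cancel_left]
  rw [hn, hre, him, Complex.re_ofReal_mul, Complex.im_ofReal_mul, Complex.exp_ofReal_mul_I_re,
    Complex.exp_ofReal_mul_I_im, show 2 * Real.pi / 3 / 2 = Real.pi / 3 by ring]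
  rw [Real.cos_sub] at hc
  have := mul_le_mul_of_nonneg_right hc (mul_nonneg hr (norm_nonneg z))
  linarith

/-- Given any sector of vertex `z` and amplitude `120°` whose axis is the ray from `z`
through `0`, some expanded octant `σ̃_j(z) = z + σ̃_j` is contained in it. -/
theorem expanded_octant_in_sector (z : ℂ) (hz : z ≠ 0) :
    ∃ j : ℕ, 1 ≤ j ∧ j ≤ 8 ∧
      (fun w => z + w) '' expOctant j ⊆ sector z (2 * Real.pi / 3) := by
  have hpi := Real.pi_pos
  set α := Complex.arg (-z) with hα
  have hre : (-z).re = ‖z‖ * Real.cos α := by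
    rw [← norm_neg z]; exact (Complex.norm_mul_cos_arg (-z)).symm
  have him : (-z).im = ‖z‖ * Real.sin α := by
    rw [← norm_neg z]; exact (Complex.norm_mul_sin_arg (-z)).symm
  have hl : -Real.pi < α := Complex.neg_pi_lt_arg _
  have hu : α ≤ Real.pi := Complex.arg_le_pi _
  obtain ⟨k, hk⟩ : ∃ k : ℤ, k = ⌈α * 4 / Real.pi⌉ := ⟨_, rfl⟩
  have hk1 : α ≤ k * Real.pi / 4 := by
    have := Int.le_ceil (α * 4 / Real.pi)
    rw [← hk, div_le_iff₀ hpi] at this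
    linarith
  have hk2 : ((k : ℝ) - 1) * Real.pi / 4 ≤ α := by
    have := Int.ceil_lt_add_one (α * 4 / Real.pi)
    rw [← hk, ← sub_lt_iff_lt_add, lt_div_iff₀ hpi] at this
    linarith
  have hk4 : k ≤ 4 := by
    rw [hk, Int.ceil_le, div_le_iff₀ hpi]; push_cast; linarith
  have hk3 : -4 < k := by
    rw [hk, Int.lt_ceil, lt_div_iff₀ hpi]; push_cast; linarith
  by_cases h : 1 ≤ k
  · have hj : ((k.toNat : ℕ) : ℝ) = k := by
      have : ((k.toNat : ℕ) : ℤ) = k := Int.toNat_of_nonneg (by omega)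
      exact_mod_cast this
    refine ⟨k.toNat, by omega, by omega, octant_aux z _ α ?_ ?_ hre him⟩ <;> rw [hj] <;> assumption
  · have hj : (((k + 8).toNat : ℕ) : ℝ) = k + 8 := by
      have : (((k + 8).toNat : ℕ) : ℤ) = k + 8 := Int.toNat_of_nonneg (by omega)
      exact_mod_cast this
    refine ⟨(k + 8).toNat, by omega, by omega, octant_aux z _ (α + 2 * Real.pi) ?_ ?_
      (by rw [Real.cos_add_two_pi, hre]) (by rw [Real.sin_add_two_pi, him])⟩ <;> rw [hj] <;> linarith
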